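/- arXiv:2503.15748 — 2 statements merged into one kernel-verified Lean document; each statement's English description precedes it below -/
import Mathlib

section
/- Average-iterate bound for AProx: for every integer t ≥ 1, the weighted average w̄^t := (Σ_{s=1}^t η_s)^{-1} Σ_{s=1}^t η_s w^s satisfies F_λ(w̄^t) − F_λ(w*) ≤ ( (G²/ρ) Σ_{s=1}^t η_s² + D_h(w*, w^0) ) / ( Σ_{s=1}^t η_s ). -/
open RealInnerProductSpace

theorem aprox_tangent {E : Type*} [NormedAddCommGroup E] [InnerProductSpace ℝ E]
    (h : E → ℝ) (hd : Differentiable ℝ h) (hc : ConvexOn ℝ Set.univ h) (x y : E) :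
    h x + fderiv ℝ h x (y - x) ≤ h y := by
  have h1 : HasDerivAt (fun r : ℝ => h (AffineMap.lineMap x y r)) (fderiv ℝ h x (y - x)) 0 := by
    have hx : HasFDerivAt h (fderiv ℝ h x) (AffineMap.lineMap x y (0:ℝ)) := by
      simpa using (hd x).hasFDerivAt
    exact hx.comp_hasDerivAt (0:ℝ) AffineMap.hasDerivAt_lineMap
  have h2 : ConvexOn ℝ Set.univ (fun r : ℝ => h (AffineMap.lineMap x y r)) :=
    hc.comp_affineMap (AffineMap.lineMap x y)
  have h3 := h2.le_slope_of_hasDerivAt (Set.mem_univ 0) (Set.mem_univ 1) one_pos h1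
  simp [slope] at h3
  linarith [map_sub (fderiv ℝ h x) y x]

/-- Average-iterate bound for AProx: for every integer `t ≥ 1`, the
weighted average `w̄^t := (Σ_{s=1}^t η_s)⁻¹ Σ_{s=1}^t η_s w^s` satisfies
`F_λ(w̄^t) − F_λ(w*) ≤ ( (G²/ρ) Σ_{s=1}^t η_s² + D_h(w*, w^0) ) / ( Σ_{s=1}^t η_s )`. -/
theorem aprox_average_iterate_bound
    {E : Type*} [NormedAddCommGroup E] [InnerProductSpace ℝ E] [FiniteDimensional ℝ E]
    (Ψ : E → ℝ) (GΨ : ℝ) (hGΨ : 0 ≤ GΨ)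
    (hΨconv : ConvexOn ℝ Set.univ Ψ)
    (hΨlip : ∀ x y : E, |Ψ x - Ψ y| ≤ GΨ * ‖x - y‖)
    (lam : ℝ) (hlam : 0 ≤ lam)
    (Gf : ℝ) (hGf : 0 ≤ Gf)
    (ρ : ℝ) (hρ : 0 < ρ)
    (h : E → ℝ) (hhdiff : Differentiable ℝ h)
    (hhsc : StrongConvexOn Set.univ ρ h)
    (Dh : E → E → ℝ)
    (hDh : ∀ u v : E, Dh u v = h u - h v - fderiv ℝ h v (u - v))
    (f : E → ℝ)
    (hfconv : ConvexOn ℝ Set.univ f)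
    (hflip : ∀ x y : E, |f x - f y| ≤ Gf * ‖x - y‖)
    (G : ℝ) (hG : G = Gf + lam * GΨ)
    (wstar : E)
    (hstar : ∀ y : E, f wstar + lam * Ψ wstar ≤ f y + lam * Ψ y)
    (η : ℕ → ℝ) (hη : ∀ t, 1 ≤ t → 0 < η t)
    (w g : ℕ → E)
    (hw1 : w 1 = w 0)
    (hsub : ∀ s, 1 ≤ s → ∀ y : E, f (w s) + ⟪g s, y - w s⟫ ≤ f y)
    (hgnorm : ∀ s, 1 ≤ s → ‖g s‖ ≤ Gf)
    (hiter : ∀ t, 1 ≤ t → ∀ y : E,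
      (∑ s ∈ Finset.Icc 1 t, η s * (⟪g s, w (t + 1)⟫ + lam * Ψ (w (t + 1))))
          + Dh (w (t + 1)) (w 0)
        ≤ (∑ s ∈ Finset.Icc 1 t, η s * (⟪g s, y⟫ + lam * Ψ y)) + Dh y (w 0)) :
    ∀ t : ℕ, 1 ≤ t → ∀ wbar : E,
      wbar = (∑ s ∈ Finset.Icc 1 t, η s)⁻¹ • ∑ s ∈ Finset.Icc 1 t, η s • w s →
      (f wbar + lam * Ψ wbar) - (f wstar + lam * Ψ wstar)
        ≤ ((G ^ 2 / ρ) * ∑ s ∈ Finset.Icc 1 t, (η s) ^ 2 + Dh wstar (w 0))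
            / (∑ s ∈ Finset.Icc 1 t, η s) := by
  classical
  intro t ht wbar hwbar
  have hG0 : 0 ≤ G := by rw [hG]; positivity
  set l : ℕ → E → ℝ := fun s y => η s * (⟪g s, y⟫ + lam * Ψ y) with hl
  set φ : ℕ → E → ℝ := fun n y => (∑ s ∈ Finset.Icc 1 n, l s y) + Dh y (w 0) with hφ
  have hmin : ∀ n y, φ n (w (n + 1)) ≤ φ n y := by
    intro n y
    rcases Nat.eq_zero_or_pos n with rfl | hn
    · simp only [hφ, zero_add, hw1]
      have := aprox_tangent h hhdiff (hhsc.convexOn (fun r => by positivity)) (w 0) y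
      simp [hDh]
      linarith [map_sub (fderiv ℝ h (w 0)) y (w 0)]
    · exact hiter n hn y
  have hlmid : ∀ s, 1 ≤ s → ∀ x y : E,
      l s ((1/2:ℝ) • x + (1/2:ℝ) • y) ≤ (1/2) * l s x + (1/2) * l s y := by
    intro s hs x y
    have h1 := hΨconv.2 (Set.mem_univ x) (Set.mem_univ y) (by norm_num : (0:ℝ) ≤ 1/2)
      (by norm_num : (0:ℝ) ≤ 1/2) (by norm_num)
    simp only [smul_eq_mul] at h1
    have h2 := mul_le_mul_of_nonneg_left (mul_le_mul_of_nonneg_left h1 hlam) (hη s hs).le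
    simp only [hl, inner_add_right, inner_smul_right]
    linarith
  have hDmid : ∀ x y : E, Dh ((1/2:ℝ) • x + (1/2:ℝ) • y) (w 0)
      ≤ (1/2) * Dh x (w 0) + (1/2) * Dh y (w 0) - ρ / 8 * ‖x - y‖ ^ 2 := by
    intro x y
    have h1 := hhsc.2 (Set.mem_univ x) (Set.mem_univ y) (by norm_num : (0:ℝ) ≤ 1/2)
      (by norm_num : (0:ℝ) ≤ 1/2) (by norm_num)
    simp only [smul_eq_mul] at h1
    simp only [hDh, map_sub, map_add, map_smul, smul_eq_mul]
    linarith
  have hgrow : ∀ n y, φ n (w (n + 1)) + ρ / 4 * ‖w (n + 1) - y‖ ^ 2 ≤ φ n y := by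
    intro n y
    have h1 := hmin n ((1/2:ℝ) • w (n + 1) + (1/2:ℝ) • y)
    have h2 := hDmid (w (n + 1)) y
    have h3 : ∑ s ∈ Finset.Icc 1 n, l s ((1/2:ℝ) • w (n + 1) + (1/2:ℝ) • y)
        ≤ (1/2) * ∑ s ∈ Finset.Icc 1 n, l s (w (n + 1))
          + (1/2) * ∑ s ∈ Finset.Icc 1 n, l s y := by
      rw [Finset.mul_sum, Finset.mul_sum, ← Finset.sum_add_distrib]
      exact Finset.sum_le_sum fun s hs => hlmid s (Finset.mem_Icc.1 hs).1 _ _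
    simp only [hφ] at h1 ⊢
    linarith
  have hllip : ∀ s, 1 ≤ s → ∀ x y : E, l s x - l s y ≤ η s * (G * ‖x - y‖) := by
    intro s hs x y
    have h1 : ⟪g s, x - y⟫ ≤ Gf * ‖x - y‖ :=
      (real_inner_le_norm _ _).trans
        (mul_le_mul_of_nonneg_right (hgnorm s hs) (norm_nonneg _))
    have h2 := mul_le_mul_of_nonneg_left ((le_abs_self _).trans (hΨlip x y)) hlam
    rw [inner_sub_right] at h1
    have h3 : (⟪g s, x⟫ + lam * Ψ x) - (⟪g s, y⟫ + lam * Ψ y) ≤ G * ‖x - y‖ := by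
      rw [hG]; linarith
    have h4 := mul_le_mul_of_nonneg_left h3 (hη s hs).le
    simp only [hl]
    linarith
  have hind : ∀ n, ∑ s ∈ Finset.Icc 1 n, l s (w s)
      ≤ φ n (w (n + 1)) + (G ^ 2 / ρ) * ∑ s ∈ Finset.Icc 1 n, (η s) ^ 2 := by
    intro n
    induction n with
    | zero => simp [hφ, hw1, hDh]
    | succ n ih =>
      rw [Finset.sum_Icc_succ_top (by omega), Finset.sum_Icc_succ_top (by omega)]
      have h1 := hgrow n (w (n + 1 + 1))
      have h2 := hllip (n + 1) (by omega) (w (n + 1)) (w (n + 1 + 1))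
      have h3 : φ (n + 1) (w (n + 1 + 1)) = φ n (w (n + 1 + 1)) + l (n + 1) (w (n + 1 + 1)) := by
        simp only [hφ]
        rw [Finset.sum_Icc_succ_top (by omega)]
        ring
      set d := ‖w (n + 1) - w (n + 1 + 1)‖
      have h4 : η (n + 1) * (G * d) ≤ ρ / 4 * d ^ 2 + G ^ 2 / ρ * η (n + 1) ^ 2 := by
        have : ρ / 4 * d ^ 2 + G ^ 2 / ρ * η (n + 1) ^ 2 - η (n + 1) * (G * d)
          = (ρ * d / 2 - G * η (n + 1)) ^ 2 / ρ := by
          field_simp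
          ring
        have h5 : 0 ≤ (ρ * d / 2 - G * η (n + 1)) ^ 2 / ρ := by positivity
        linarith
      rw [h3]
      linarith
  have hpos : 0 < ∑ s ∈ Finset.Icc 1 t, η s :=
    Finset.sum_pos (fun s hs => hη s (Finset.mem_Icc.1 hs).1) ⟨1, by simp [ht]⟩
  have hFconv : ConvexOn ℝ Set.univ (fun y => f y + lam * Ψ y) :=
    hfconv.add (hΨconv.smul hlam)
  have hJ := hFconv.map_centerMass_le (t := Finset.Icc 1 t) (w := η) (p := w)
    (fun s hs => (hη s (Finset.mem_Icc.1 hs).1).le) hpos (fun _ _ => Set.mem_univ _)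
  simp only [Finset.centerMass, ← hwbar, Function.comp_def, smul_eq_mul] at hJ
  have hreg : ∑ s ∈ Finset.Icc 1 t, η s * (f (w s) + lam * Ψ (w s))
      ≤ (∑ s ∈ Finset.Icc 1 t, η s) * (f wstar + lam * Ψ wstar)
        + ((∑ s ∈ Finset.Icc 1 t, l s (w s)) - ∑ s ∈ Finset.Icc 1 t, l s wstar) := by
    rw [Finset.sum_mul, ← Finset.sum_sub_distrib, ← Finset.sum_add_distrib]
    refine Finset.sum_le_sum fun s hs => ?_
    have hs1 := (Finset.mem_Icc.1 hs).1
    have h1 := mul_le_mul_of_nonneg_left (hsub s hs1 wstar) (hη s hs1).le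
    rw [inner_sub_right] at h1
    simp only [hl]
    linarith
  have h1 := hind t
  have h2 := hmin t wstar
  have h3 : φ t wstar = (∑ s ∈ Finset.Icc 1 t, l s wstar) + Dh wstar (w 0) := rfl
  rw [inv_mul_eq_div, le_div_iff₀ hpos] at hJ
  rw [le_div_iff₀ hpos]
  linarith
end

section
/- Last-iterate convergence of AProx with an optimal constant step size: assume G > 0 and D := D_h(w*, w^0) > 0, fix an integer T ≥ 1, and use the constant step sizes η_s = (1/G)·√(D ρ / ((2 + ln T) T)) for s = 1, …, T. Then the last iterate satisfies F_λ(w^T) − F_λ(w*) ≤ 2 G √( D (2 + ln T) / (ρ T) ). -/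
open RealInnerProductSpace

lemma aux_scmin {E : Type*} [NormedAddCommGroup E] [InnerProductSpace ℝ E]
    (φ : E → ℝ) (ρ : ℝ) (hs : StrongConvexOn Set.univ ρ φ) (m : E)
    (hm : ∀ y, φ m ≤ φ y) (y : E) : φ m + ρ / 2 * ‖y - m‖ ^ 2 ≤ φ y := by
  have key : ∀ b : ℝ, 0 < b → b < 1 → (1 - b) * (ρ / 2 * ‖y - m‖ ^ 2) ≤ φ y - φ m := by
    intro b hb hb1
    have h1 := hs.2 (Set.mem_univ y) (Set.mem_univ m) hb.le (sub_nonneg.2 hb1.le) (by ring)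
    have h2 := hm (b • y + (1 - b) • m)
    simp only [smul_eq_mul] at h1
    have h3 : b * ((1 - b) * (ρ / 2 * ‖y - m‖ ^ 2)) ≤ b * (φ y - φ m) := by linarith
    exact le_of_mul_le_mul_left h3 hb
  have ht : Filter.Tendsto (fun b : ℝ => (1 - b) * (ρ / 2 * ‖y - m‖ ^ 2))
      (nhdsWithin 0 (Set.Ioi 0)) (nhds ((1 - 0) * (ρ / 2 * ‖y - m‖ ^ 2))) := by
    apply Filter.Tendsto.mono_left _ nhdsWithin_le_nhds
    exact Continuous.tendsto (by fun_prop) 0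
  have h4 := le_of_tendsto ht (by
    filter_upwards [Ioo_mem_nhdsGT (zero_lt_one' ℝ)] with b hb
    exact key b hb.1 hb.2)
  linarith

lemma aux_grad {E : Type*} [NormedAddCommGroup E] [InnerProductSpace ℝ E]
    (h : E → ℝ) (hd : Differentiable ℝ h) (hc : ConvexOn ℝ Set.univ h) (v u : E) :
    0 ≤ h u - h v - fderiv ℝ h v (u - v) := by
  have hc' : ConvexOn ℝ Set.univ (fun t : ℝ => h (AffineMap.lineMap v u t)) := by
    have := hc.comp_affineMap (AffineMap.lineMap (k := ℝ) v u)
    simpa [Function.comp_def] using this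
  have hdv : HasDerivAt (fun t : ℝ => h (AffineMap.lineMap v u t)) (fderiv ℝ h v (u - v)) 0 := by
    have h1 : HasFDerivAt h (fderiv ℝ h v) (AffineMap.lineMap v u (0 : ℝ)) := by
      simpa using (hd v).hasFDerivAt
    exact h1.comp_hasDerivAt (0 : ℝ) AffineMap.hasDerivAt_lineMap
  have := hc'.le_slope_of_hasDerivAt (Set.mem_univ 0) (Set.mem_univ 1) one_pos hdv
  simp [slope_def_field] at this
  simp; linarith

lemma aux_avg (d : ℕ → ℝ) (c : ℝ) (N : ℕ)
    (hd : ∀ k < N, ∑ j ∈ Finset.range (k + 1), (d j - d k) ≤ (k + 1 : ℝ) * c) :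
    ∀ n < N, d 0 ≤ (∑ j ∈ Finset.range (n + 1), d j) / (n + 1 : ℝ) + c * (harmonic n : ℝ) := by
  intro n
  induction n with
  | zero => intro _; simp
  | succ n ih =>
    intro hn
    have h1 := ih (by omega)
    have h2 := hd (n + 1) hn
    rw [Finset.sum_sub_distrib, Finset.sum_const, Finset.card_range, nsmul_eq_mul,
      Finset.sum_range_succ] at h2
    rw [Finset.sum_range_succ, harmonic_succ]
    push_cast at h2 ⊢
    set S := ∑ j ∈ Finset.range (n + 1), d j
    have hp : (0 : ℝ) < n + 1 := by positivity
    have hp2 : (0 : ℝ) < n + 1 + 1 := by positivity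
    have h3 : S / (n + 1 : ℝ) ≤ (S + d (n + 1)) / (n + 1 + 1 : ℝ) + c * (n + 1 : ℝ)⁻¹ := by
      have e : (S + d (n + 1)) / (n + 1 + 1 : ℝ) + c * (n + 1 : ℝ)⁻¹ - S / (n + 1 : ℝ)
          = ((n + 1 + 1 : ℝ) * c - (S + d (n + 1) - (n + 1 + 1 : ℝ) * d (n + 1)))
            / ((n + 1) * (n + 1 + 1)) := by
        field_simp
        ring
      have : 0 ≤ ((n + 1 + 1 : ℝ) * c - (S + d (n + 1) - (n + 1 + 1 : ℝ) * d (n + 1)))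
            / ((n + 1) * (n + 1 + 1)) := div_nonneg (by linarith) (by positivity)
      linarith
    rw [mul_add]
    linarith

lemma aux_final (D ρ G L T e : ℝ) (hD : 0 < D) (hρ : 0 < ρ) (hG : 0 < G) (hL : 0 < L)
    (hT : 0 < T) (he : e = (1 / G) * Real.sqrt (D * ρ / (L * T))) :
    D / (e * T) + e * G ^ 2 / (2 * ρ) * L ≤ 2 * G * Real.sqrt (D * L / (ρ * T)) := by
  set R := Real.sqrt (D * L / (ρ * T)) with hR
  have hRp : 0 < R := Real.sqrt_pos.2 (by positivity)
  have hR2 : R ^ 2 = D * L / (ρ * T) := Real.sq_sqrt (by positivity)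
  have h1 : Real.sqrt (D * ρ / (L * T)) = R * ρ / L := by
    rw [Real.sqrt_eq_iff_mul_self_eq (by positivity) (by positivity)]
    have : R * ρ / L * (R * ρ / L) = R ^ 2 * ρ ^ 2 / L ^ 2 := by ring
    rw [this, hR2]; field_simp
  have h2 : D = R ^ 2 * (ρ * T) / L := by rw [hR2]; field_simp
  have h3 : D / (e * T) = G * R := by
    rw [he, h1, h2]; field_simp
  have h4 : e * G ^ 2 / (2 * ρ) * L = G * R / 2 := by
    rw [he, h1]; field_simp
  rw [h3, h4]
  nlinarith [mul_pos hG hRp]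

/-- Last-iterate convergence of AProx with an optimal constant step
size: assume `G > 0` and `D := D_h(w*, w^0) > 0`, fix `T ≥ 1`, and use
`η_s = (1/G)·√(D ρ / ((2 + ln T) T))` for `s = 1, …, T`. Then the last iterate
satisfies `F_λ(w^T) − F_λ(w*) ≤ 2 G √( D (2 + ln T) / (ρ T) )`. -/
theorem aprox_last_iterate_constant_step
    {E : Type*} [NormedAddCommGroup E] [InnerProductSpace ℝ E] [FiniteDimensional ℝ E]
    (Ψ : E → ℝ) (GΨ : ℝ) (hGΨ : 0 ≤ GΨ)
    (hΨconv : ConvexOn ℝ Set.univ Ψ)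
    (hΨlip : ∀ x y : E, |Ψ x - Ψ y| ≤ GΨ * ‖x - y‖)
    (lam : ℝ) (hlam : 0 ≤ lam)
    (Gf : ℝ) (hGf : 0 ≤ Gf)
    (ρ : ℝ) (hρ : 0 < ρ)
    (h : E → ℝ) (hhdiff : Differentiable ℝ h)
    (hhsc : StrongConvexOn Set.univ ρ h)
    (Dh : E → E → ℝ)
    (hDh : ∀ u v : E, Dh u v = h u - h v - fderiv ℝ h v (u - v))
    (f : E → ℝ)
    (hfconv : ConvexOn ℝ Set.univ f)
    (hflip : ∀ x y : E, |f x - f y| ≤ Gf * ‖x - y‖)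
    (G : ℝ) (hG : G = Gf + lam * GΨ) (hGpos : 0 < G)
    (wstar : E)
    (hstar : ∀ y : E, f wstar + lam * Ψ wstar ≤ f y + lam * Ψ y)
    (η : ℕ → ℝ) (hη : ∀ t, 1 ≤ t → 0 < η t)
    (w g : ℕ → E)
    (hw1 : w 1 = w 0)
    (hsub : ∀ s, 1 ≤ s → ∀ y : E, f (w s) + ⟪g s, y - w s⟫ ≤ f y)
    (hgnorm : ∀ s, 1 ≤ s → ‖g s‖ ≤ Gf)
    (hiter : ∀ t, 1 ≤ t → ∀ y : E,
      (∑ s ∈ Finset.Icc 1 t, η s * (⟪g s, w (t + 1)⟫ + lam * Ψ (w (t + 1))))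
          + Dh (w (t + 1)) (w 0)
        ≤ (∑ s ∈ Finset.Icc 1 t, η s * (⟪g s, y⟫ + lam * Ψ y)) + Dh y (w 0))
    (T : ℕ) (hT : 1 ≤ T)
    (D : ℝ) (hD : D = Dh wstar (w 0)) (hDpos : 0 < D)
    (hηconst : ∀ s : ℕ, 1 ≤ s → s ≤ T →
      η s = (1 / G) * Real.sqrt (D * ρ / ((2 + Real.log T) * T))) :
    (f (w T) + lam * Ψ (w T)) - (f wstar + lam * Ψ wstar)
      ≤ 2 * G * Real.sqrt (D * (2 + Real.log T) / (ρ * T)) := by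
  have hTpos : (0 : ℝ) < T := by exact_mod_cast hT
  have hlog : 0 ≤ Real.log T := Real.log_natCast_nonneg T
  have hL : 0 < 2 + Real.log T := by linarith
  obtain ⟨e, he⟩ : ∃ e, e = (1 / G) * Real.sqrt (D * ρ / ((2 + Real.log T) * T)) := ⟨_, rfl⟩
  have hepos : 0 < e := by rw [he, ← hηconst 1 le_rfl hT]; exact hη 1 le_rfl
  have hηe : ∀ s, 1 ≤ s → s ≤ T → η s = e := fun s h1 h2 => by rw [he]; exact hηconst s h1 h2
  have hhconv : ConvexOn ℝ Set.univ h :=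
    UniformConvexOn.convexOn hhsc (fun r => by positivity)
  obtain ⟨Φ, hΦ⟩ : ∃ Φ : ℕ → E → ℝ, ∀ t y, Φ t y =
      (∑ s ∈ Finset.Icc 1 t, η s * (⟪g s, y⟫ + lam * Ψ y)) + Dh y (w 0) :=
    ⟨fun t y => _, fun _ _ => rfl⟩
  have hΦ0 : ∀ y, Φ 0 y = Dh y (w 0) := fun y => by simp [hΦ]
  have hΦs : ∀ t y, Φ (t + 1) y = Φ t y + η (t + 1) * (⟪g (t + 1), y⟫ + lam * Ψ y) := by
    intro t y
    rw [hΦ, hΦ, Finset.sum_Icc_succ_top (by omega)]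
    ring
  have hsc : ∀ t, StrongConvexOn Set.univ ρ (Φ t) := by
    intro t
    induction t with
    | zero =>
      refine ⟨convex_univ, fun x hx y hy a b ha hb hab => ?_⟩
      have h1 := hhsc.2 hx hy ha hb hab
      simp only [hΦ0, hDh, map_sub, map_add, map_smul, smul_eq_mul] at h1 ⊢
      have hb' : b = 1 - a := by linarith
      subst hb'
      linarith
    | succ t ih =>
      refine ⟨convex_univ, fun x hx y hy a b ha hb hab => ?_⟩
      have h1 := ih.2 hx hy ha hb hab
      have h2 := hΨconv.2 hx hy ha hb hab
      have h3 : η (t + 1) * (lam * Ψ (a • x + b • y)) ≤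
          η (t + 1) * (lam * (a * Ψ x + b * Ψ y)) := by
        have := (hη (t + 1) (by omega)).le
        gcongr
        simpa using h2
      simp only [hΦs, inner_add_right, inner_smul_right, smul_eq_mul] at h1 ⊢
      linarith
  have hmin : ∀ t y, Φ t (w (t + 1)) ≤ Φ t y := by
    intro t y
    rcases Nat.eq_zero_or_pos t with rfl | ht
    · rw [hΦ0, hΦ0, zero_add, hw1, hDh, hDh]
      have := aux_grad h hhdiff hhconv (w 0) y
      simpa using this
    · rw [hΦ, hΦ]; exact hiter t ht y
  have hstep : ∀ t, t + 1 ≤ T →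
      Φ (t + 1) (w (t + 1)) ≤ Φ (t + 1) (w (t + 1 + 1)) + e * (e * G ^ 2 / (2 * ρ)) := by
    intro t ht
    have h1 := aux_scmin (Φ t) ρ (hsc t) (w (t + 1)) (hmin t) (w (t + 1 + 1))
    rw [hΦs, hΦs, hηe (t + 1) (by omega) ht]
    set x := w (t + 1)
    set z := w (t + 1 + 1)
    have h2 : ⟪g (t + 1), x⟫ - ⟪g (t + 1), z⟫ ≤ Gf * ‖z - x‖ := by
      rw [← inner_sub_right, ← norm_sub_rev x z]
      exact (real_inner_le_norm _ _).trans
        (mul_le_mul_of_nonneg_right (hgnorm _ (by omega)) (norm_nonneg _))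
    have h3 : lam * (Ψ x - Ψ z) ≤ lam * (GΨ * ‖z - x‖) := by
      rw [← norm_sub_rev x z]
      exact mul_le_mul_of_nonneg_left ((le_abs_self _).trans (hΨlip x z)) hlam
    have h4 : (⟪g (t + 1), x⟫ + lam * Ψ x) - (⟪g (t + 1), z⟫ + lam * Ψ z) ≤ G * ‖z - x‖ := by
      rw [hG]; linarith
    have h5 := mul_le_mul_of_nonneg_left h4 hepos.le
    have h6 : e * (G * ‖z - x‖) ≤ ρ / 2 * ‖z - x‖ ^ 2 + e * (e * G ^ 2 / (2 * ρ)) := by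
      have : ρ / 2 * ‖z - x‖ ^ 2 + e * (e * G ^ 2 / (2 * ρ)) - e * (G * ‖z - x‖)
          = (ρ * ‖z - x‖ - e * G) ^ 2 / (2 * ρ) := by
        field_simp
        ring
      have h7 : 0 ≤ (ρ * ‖z - x‖ - e * G) ^ 2 / (2 * ρ) := by positivity
      linarith
    linarith
  obtain ⟨F, hF⟩ : ∃ F : E → ℝ, ∀ x, F x = f x + lam * Ψ x := ⟨fun x => _, fun _ => rfl⟩
  obtain ⟨c, hc⟩ : ∃ c, c = e * G ^ 2 / (2 * ρ) := ⟨_, rfl⟩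
  have hcpos : 0 ≤ c := by rw [hc]; positivity
  rw [← hc] at hstep
  have hreg : ∀ (b : ℕ) (u : E) (n : ℕ), b + n ≤ T →
      ∑ j ∈ Finset.range n, e * (F (w (b + j + 1)) - F u) + Φ b (w (b + 1)) - Φ b u
        ≤ Φ (b + n) (w (b + n + 1)) - Φ (b + n) u + n * (e * c) := by
    intro b u n
    induction n with
    | zero => intro _; simp
    | succ n ih =>
      intro hn
      have h1 := ih (by omega)
      have h2 := hstep (b + n) (by omega)
      have h3 := hsub (b + n + 1) (by omega) u
      rw [inner_sub_right] at h3
      have h4 : e * (F (w (b + n + 1)) - F u) ≤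
          e * ((⟪g (b + n + 1), w (b + n + 1)⟫ + lam * Ψ (w (b + n + 1)))
            - (⟪g (b + n + 1), u⟫ + lam * Ψ u)) := by
        apply mul_le_mul_of_nonneg_left _ hepos.le
        rw [hF, hF]; linarith
      have h5 := hΦs (b + n) (w (b + n + 1))
      have h6 := hΦs (b + n) u
      rw [hηe (b + n + 1) (by omega) (by omega)] at h5 h6
      rw [Finset.sum_range_succ, ← add_assoc b n 1]
      push_cast
      linarith
  have hreg2 : ∀ (b : ℕ) (u : E) (n : ℕ), b + n ≤ T →
      e * ∑ j ∈ Finset.range n, (F (w (b + j + 1)) - F u)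
        ≤ Φ b u - Φ b (w (b + 1)) + n * (e * c) := by
    intro b u n hn
    have h1 := hreg b u n hn
    have h2 := hmin (b + n) u
    rw [Finset.mul_sum]
    linarith
  have havg := aux_avg (fun j => F (w (T - j)) - F wstar) c T (by
    intro k hk
    have h1 := hreg2 (T - k - 1) (w (T - k - 1 + 1)) (k + 1) (by omega)
    rw [sub_self, zero_add] at h1
    have h2 : ∑ j ∈ Finset.range (k + 1), ((F (w (T - j)) - F wstar) - (F (w (T - k)) - F wstar))
        = ∑ j ∈ Finset.range (k + 1),
          (F (w (T - k - 1 + j + 1)) - F (w (T - k - 1 + 1))) := by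
      rw [← Finset.sum_range_reflect]
      apply Finset.sum_congr rfl
      intro j hj
      rw [Finset.mem_range] at hj
      rw [show T - (k + 1 - 1 - j) = T - k - 1 + j + 1 by omega,
        show T - k - 1 + 1 = T - k by omega]
      ring
    rw [h2]
    apply le_of_mul_le_mul_left _ hepos
    push_cast at h1
    linarith) (T - 1) (by omega)
  have hTT : T - 1 + 1 = T := by omega
  have hcast : ((T - 1 : ℕ) : ℝ) + 1 = T := by exact_mod_cast hTT
  rw [hTT, hcast] at havg
  have hsum := hreg2 0 wstar T (by omega)
  have hrefl : ∑ j ∈ Finset.range T, (F (w (T - j)) - F wstar)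
      = ∑ j ∈ Finset.range T, (F (w (0 + j + 1)) - F wstar) := by
    rw [← Finset.sum_range_reflect]
    apply Finset.sum_congr rfl
    intro j hj
    rw [Finset.mem_range] at hj
    rw [show T - (T - 1 - j) = 0 + j + 1 by omega]
  rw [← hrefl, hΦ0, hΦ0, zero_add, hw1, ← hD] at hsum
  have hD0 : Dh (w 0) (w 0) = 0 := by rw [hDh]; simp
  rw [hD0, sub_zero] at hsum
  simp only [Nat.sub_zero] at havg
  set S := ∑ j ∈ Finset.range T, (F (w (T - j)) - F wstar)
  have hS : S / T ≤ D / (e * T) + c := by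
    have : D / (e * T) + c - S / T = (D + T * (e * c) - e * S) / (e * T) := by
      field_simp
    have h2 : 0 ≤ (D + T * (e * c) - e * S) / (e * T) :=
      div_nonneg (by linarith) (by positivity)
    linarith
  have hharm : (harmonic (T - 1) : ℝ) ≤ 1 + Real.log T := by
    have h1 := harmonic_le_one_add_log T
    have h2 : (harmonic T : ℝ) = harmonic (T - 1) + (T : ℝ)⁻¹ := by
      conv_lhs => rw [← hTT, harmonic_succ]
      rw [hTT]; push_cast; rfl
    have h3 : (0 : ℝ) < (T : ℝ)⁻¹ := by positivity
    linarith
  have h8 := mul_le_mul_of_nonneg_left hharm hcpos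
  have h9 := aux_final D ρ G (2 + Real.log T) T e hDpos hρ hGpos hL hTpos he
  rw [← hc] at h9
  rw [← hF, ← hF]
  linarith
end
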